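/- Let V be a nonempty finite type and k ≥ 1. Let P be a probability mass function on V^k with marginals P_t, let D ∈ ℝ^{k×k} have nonnegative entries, and let τ ∈ [0, 1]. Assume that for every t ∈ {2, …, k}, the expectation over histories Y_{<t} drawn from P of TV(P(· | Y_{<t}), P_t) is at most Σ_{j=1}^{t−1} D_{t,j}, and that Σ_{t=2}^{k} Σ_{j=1}^{t−1} D_{t,j} ≤ τ. Then there exists a coupling of P and ⊗_{t=1}^{k} P_t — i.e. a probability mass function π on V^k × V^k whose first marginal is P and whose second marginal is ⊗_{t=1}^{k} P_t — such that π({(a, b) : a = b}) ≥ 1 − τ. -/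

import Mathlib

open Finset

/-- Total variation distance between two mass functions on a finite type:
`TV(p, q) = (1/2) ∑ₓ |p x - q x|`. -/
noncomputable def tv {X : Type*} [Fintype X] (p q : X → ℝ) : ℝ :=
  (1 / 2) * ∑ x, |p x - q x|

/-- The `t`-th marginal of a mass function `P` on `Fin k → V`. -/
noncomputable def marg {V : Type*} [Fintype V] [DecidableEq V] {k : ℕ}
    (P : (Fin k → V) → ℝ) (t : Fin k) (v : V) : ℝ :=
  ∑ y : Fin k → V, if y t = v then P y else 0

/-- Probability under `P` that the first `t` coordinates agree with those of `z`. -/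
noncomputable def prefProb {V : Type*} [Fintype V] [DecidableEq V] {k : ℕ}
    (P : (Fin k → V) → ℝ) (t : ℕ) (z : Fin k → V) : ℝ :=
  ∑ y : Fin k → V, if ∀ i : Fin k, (i : ℕ) < t → y i = z i then P y else 0

/-- Conditional distribution of coordinate `t` given that the coordinates before `t`
equal those of `z` (Lean's division-by-zero convention handles zero-probability
histories, which are anyway weighted by zero below). -/
noncomputable def condD {V : Type*} [Fintype V] [DecidableEq V] {k : ℕ}
    (P : (Fin k → V) → ℝ) (t : Fin k) (z : Fin k → V) (v : V) : ℝ :=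
  prefProb P ((t : ℕ) + 1) (Function.update z t v) / prefProb P (t : ℕ) z

/-- Extend a history on the first `t` coordinates to a full configuration. -/
noncomputable def extendHist {V : Type*} [Nonempty V] {k t : ℕ}
    (h : Fin t → V) : Fin k → V :=
  fun i => if hi : (i : ℕ) < t then h ⟨i, hi⟩ else Classical.arbitrary V

/-- Expectation, over histories `Y_{<t}` drawn from `P`, of the total variation
distance between the conditional distribution of the `t`-th coordinate given the
history and the `t`-th marginal. -/
noncomputable def expCondTV {V : Type*} [Fintype V] [DecidableEq V] [Nonempty V] {k : ℕ}
    (P : (Fin k → V) → ℝ) (t : Fin k) : ℝ :=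
  ∑ h : Fin (t : ℕ) → V,
    prefProb P (t : ℕ) (extendHist h) * tv (condD P t (extendHist h)) (marg P t)

/-- Maximal coupling of two mass functions on a finite type. -/
theorem exists_maximal_coupling {X : Type*} [Fintype X] [DecidableEq X] (p q : X → ℝ)
    (hp0 : ∀ x, 0 ≤ p x) (hq0 : ∀ x, 0 ≤ q x) (hp1 : ∑ x, p x = 1) (hq1 : ∑ x, q x = 1) :
    ∃ π : X × X → ℝ, (∀ x, 0 ≤ π x) ∧ (∑ x, π x = 1) ∧
      (∀ a, ∑ b, π (a, b) = p a) ∧ (∀ b, ∑ a, π (a, b) = q b) ∧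
      1 - tv p q ≤ ∑ x ∈ univ.filter (fun x : X × X => x.1 = x.2), π x := by
  let m : X → ℝ := fun x => min (p x) (q x)
  let δ : ℝ := 1 - ∑ x, m x
  have hm0 : ∀ x, 0 ≤ m x := fun x => le_min (hp0 x) (hq0 x)
  have hmp : ∀ x, 0 ≤ p x - m x := fun x => sub_nonneg.2 (min_le_left _ _)
  have hmq : ∀ x, 0 ≤ q x - m x := fun x => sub_nonneg.2 (min_le_right _ _)
  have hpδ : ∑ x, (p x - m x) = δ := by rw [sum_sub_distrib, hp1]
  have hqδ : ∑ x, (q x - m x) = δ := by rw [sum_sub_distrib, hq1]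
  have hδ : 0 ≤ δ := hpδ ▸ sum_nonneg fun x _ => hmp x
  have cancel : ∀ r : X → ℝ, (∀ x, 0 ≤ r x) → ∑ x, r x = δ → ∀ a, r a * δ / δ = r a := by
    intro r hr hs a
    by_cases h : δ = 0
    · have := (sum_eq_zero_iff_of_nonneg fun x _ => hr x).1 (hs.trans h) a (mem_univ a)
      simp [this]
    · exact mul_div_cancel_right₀ _ h
  have hoff : ∀ a b, 0 ≤ (p a - m a) * (q b - m b) / δ := fun a b =>
    div_nonneg (mul_nonneg (hmp a) (hmq b)) hδ
  let π : X × X → ℝ := fun x =>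
    (if x.1 = x.2 then m x.1 else 0) + (p x.1 - m x.1) * (q x.2 - m x.2) / δ
  have hfst : ∀ a, ∑ b, π (a, b) = p a := by
    intro a
    simp only [π, sum_add_distrib, sum_ite_eq, mem_univ, if_true]
    rw [← sum_div, ← mul_sum, hqδ, cancel _ hmp hpδ]
    ring
  have hsnd : ∀ b, ∑ a, π (a, b) = q b := by
    intro b
    simp only [π, sum_add_distrib, sum_ite_eq', mem_univ, if_true]
    rw [← sum_div, ← sum_mul, hpδ, mul_comm, cancel _ hmq hqδ]
    ring
  refine ⟨π, fun x => add_nonneg (by split_ifs <;> simp [hm0]) (hoff _ _), ?_, hfst, hsnd, ?_⟩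
  · rw [Fintype.sum_prod_type]
    simp only [hfst, hp1]
  · have hmin : ∑ x, m x = 1 - tv p q := by
      have : ∀ x, m x = (1 / 2) * p x + (1 / 2) * q x - (1 / 2) * |p x - q x| := by
        intro x
        have h1 := min_add_max (p x) (q x)
        have h2 := max_sub_min_eq_abs' (p x) (q x)
        simp only [m]
        linarith
      simp only [this, sum_sub_distrib, sum_add_distrib, ← mul_sum, hp1, hq1, tv]
      norm_num
    rw [← hmin, sum_filter, Fintype.sum_prod_type]
    refine sum_le_sum fun a _ => ?_
    simp only [sum_ite_eq, mem_univ, if_true, π]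
    linarith [hoff a a]

theorem tv_triangle {X : Type*} [Fintype X] (p q r : X → ℝ) : tv p r ≤ tv p q + tv q r := by
  unfold tv
  rw [← mul_add, ← sum_add_distrib]
  exact mul_le_mul_of_nonneg_left (sum_le_sum fun x _ => abs_sub_le _ _ _) (by norm_num)

theorem tv_le_sum_range {X : Type*} [Fintype X] (H : ℕ → X → ℝ) (n : ℕ) :
    tv (H n) (H 0) ≤ ∑ t ∈ range n, tv (H (t + 1)) (H t) := by
  induction n with
  | zero => simp [tv]
  | succ n ih =>
    rw [sum_range_succ]
    linarith [tv_triangle (H (n + 1)) (H n) (H 0)]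

/-- Summing out the coordinates from `s` on against a product of mass functions. -/
theorem sum_prefix_mul_prod {V : Type*} [Fintype V] {k s : ℕ} (hs : s ≤ k)
    (F : (Fin s → V) → ℝ) (m : Fin k → V → ℝ) (hm : ∀ i, ∑ v, m i v = 1) :
    ∑ y : Fin k → V, F (fun i => y (Fin.castLE hs i)) *
      ∏ i : Fin k, (if s ≤ (i : ℕ) then m i (y i) else 1) = ∑ h, F h := by
  classical
  obtain ⟨r, rfl⟩ := Nat.exists_eq_add_of_le hs
  rw [← (Fin.appendEquiv s r).sum_comp, Fintype.sum_prod_type]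
  refine sum_congr rfl fun h _ => ?_
  have hpre : ∀ w : Fin r → V,
      (fun i => Fin.append h w (Fin.castLE hs i)) = h := fun w =>
    funext fun i => Fin.append_left h w i
  have key : ∑ w : Fin r → V, ∏ i, m (Fin.natAdd s i) (w i) = 1 := by
    rw [← Fintype.prod_sum]
    simp [hm]
  simp only [Fin.appendEquiv, Equiv.coe_fn_mk, hpre, Fin.prod_univ_add, Fin.append_left,
    Fin.append_right, Fin.val_castAdd, Fin.val_natAdd, Nat.le_add_right, if_true,
    not_le.2 (Fin.is_lt _), if_false, prod_const_one, one_mul]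
  rw [← mul_sum, key, mul_one]

section Marginals

variable {V : Type*} [Fintype V] [DecidableEq V] {k : ℕ} (P : (Fin k → V) → ℝ)

theorem prefProb_congr {t : ℕ} {z w : Fin k → V} (h : ∀ i : Fin k, (i : ℕ) < t → z i = w i) :
    prefProb P t z = prefProb P t w := by
  unfold prefProb
  refine sum_congr rfl fun y _ => if_congr (forall₂_congr fun i hi => ?_) rfl rfl
  rw [h i hi]

theorem prefProb_zero (z : Fin k → V) : prefProb P 0 z = ∑ y, P y := by
  simp [prefProb]

theorem prefProb_self (z : Fin k → V) : prefProb P k z = P z := by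
  simp [prefProb, ← funext_iff]

theorem sum_marg (t : Fin k) : ∑ v, marg P t v = ∑ y, P y := by
  unfold marg
  rw [sum_comm]
  simp

variable {P}

theorem marg_nonneg (hP0 : ∀ y, 0 ≤ P y) (t : Fin k) (v : V) : 0 ≤ marg P t v :=
  sum_nonneg fun y _ => by split_ifs <;> simp [hP0]

theorem prefProb_nonneg (hP0 : ∀ y, 0 ≤ P y) (t : ℕ) (z : Fin k → V) : 0 ≤ prefProb P t z :=
  sum_nonneg fun y _ => by split_ifs <;> simp [hP0]

theorem prefProb_succ_le (hP0 : ∀ y, 0 ≤ P y) (t : ℕ) (z : Fin k → V) :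
    prefProb P (t + 1) z ≤ prefProb P t z := by
  refine sum_le_sum fun y _ => ?_
  split_ifs with h1 h2 h2
  · exact le_rfl
  · exact absurd (fun i hi => h1 i (Nat.lt_succ_of_lt hi)) h2
  · exact hP0 y
  · exact le_rfl

theorem prefProb_mul_condD (hP0 : ∀ y, 0 ≤ P y) (t : Fin k) (z : Fin k → V) (v : V) :
    prefProb P t z * condD P t z v = prefProb P (t + 1) (Function.update z t v) := by
  unfold condD
  by_cases h : prefProb P t z = 0
  · have hz : prefProb P t (Function.update z t v) = prefProb P t z :=
      prefProb_congr P fun i hi => Function.update_of_ne (by rintro rfl; omega) _ _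
    have := prefProb_succ_le hP0 t (Function.update z t v)
    have := prefProb_nonneg hP0 (t + 1) (Function.update z t v)
    rw [h, zero_mul]
    linarith
  · exact mul_div_cancel₀ _ h

end Marginals

/-- The mass function drawing the first `t` coordinates from `P` and the remaining ones
independently from the marginals of `P`. -/
noncomputable def hybrid {V : Type*} [Fintype V] [DecidableEq V] {k : ℕ}
    (P : (Fin k → V) → ℝ) (t : ℕ) (y : Fin k → V) : ℝ :=
  prefProb P t y * ∏ i : Fin k, if t ≤ (i : ℕ) then marg P i (y i) else 1

section Hybrid

variable {V : Type*} [Fintype V] [DecidableEq V] {k : ℕ} {P : (Fin k → V) → ℝ}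

theorem hybrid_zero (hP1 : ∑ y, P y = 1) : hybrid P 0 = fun y => ∏ t, marg P t (y t) := by
  funext y
  simp [hybrid, prefProb_zero, hP1]

theorem hybrid_self : hybrid P k = P := by
  funext y
  simp [hybrid, prefProb_self, not_le.2 (Fin.is_lt _)]

theorem tv_hybrid_succ [Nonempty V] (hP0 : ∀ y, 0 ≤ P y) (hP1 : ∑ y, P y = 1) (t : Fin k) :
    tv (hybrid P (t + 1)) (hybrid P t) = expCondTV P t := by
  let F : (Fin (t + 1) → V) → ℝ := fun h =>
    |prefProb P (t + 1) (extendHist h) -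
      prefProb P t (extendHist h) * marg P t (h (Fin.last t))|
  have hdiff : ∀ y : Fin k → V, |hybrid P (t + 1) y - hybrid P t y| =
      F (fun i => y (Fin.castLE t.is_lt i)) *
        ∏ i : Fin k, if (t : ℕ) + 1 ≤ (i : ℕ) then marg P i (y i) else 1 := by
    intro y
    have hprod : (∏ i : Fin k, if (t : ℕ) ≤ (i : ℕ) then marg P i (y i) else 1) =
        marg P t (y t) *
          ∏ i : Fin k, if (t : ℕ) + 1 ≤ (i : ℕ) then marg P i (y i) else 1 := by
      rw [← mul_prod_erase univ _ (mem_univ t), if_pos le_rfl,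
        ← mul_prod_erase univ (fun i : Fin k => if (t : ℕ) + 1 ≤ (i : ℕ) then _ else _)
          (mem_univ t), if_neg (by omega), one_mul]
      congr 1
      refine prod_congr rfl fun i hi => if_congr ?_ rfl rfl
      have : (i : ℕ) ≠ t := fun h => ne_of_mem_erase hi (Fin.ext h)
      omega
    have hext : ∀ i : Fin k, (i : ℕ) < t + 1 →
        y i = extendHist (k := k) (fun i => y (Fin.castLE t.is_lt i)) i := by
      intro i hi
      simp only [extendHist, dif_pos hi]
      rfl
    have hnn : 0 ≤ ∏ i : Fin k, if (t : ℕ) + 1 ≤ (i : ℕ) then marg P i (y i) else 1 :=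
      prod_nonneg fun i _ => by split_ifs <;> simp [marg_nonneg hP0]
    have hlast : Fin.castLE t.is_lt (Fin.last t) = t := rfl
    simp only [hybrid, F, hprod, hlast]
    rw [prefProb_congr P hext, prefProb_congr P fun i hi => hext i (Nat.lt_succ_of_lt hi),
      ← mul_assoc, ← sub_mul, abs_mul, abs_of_nonneg hnn]
  have hF : ∀ (h : Fin t → V) (v : V), F (Fin.snoc h v) =
      prefProb P t (extendHist h) * |condD P t (extendHist h) v - marg P t v| := by
    intro h v
    have h1 : prefProb P t (extendHist (Fin.snoc h v : Fin (t + 1) → V)) =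
        prefProb P t (extendHist h) := by
      refine prefProb_congr P fun i hi => ?_
      simp [extendHist, hi, Nat.lt_succ_of_lt hi, Fin.snoc]
    have h2 : prefProb P (t + 1) (extendHist (Fin.snoc h v : Fin (t + 1) → V)) =
        prefProb P (t + 1) (Function.update (extendHist h) t v) := by
      refine prefProb_congr P fun i hi => ?_
      by_cases hit : i = t
      · subst hit
        simp [extendHist, Fin.snoc]
      · have hlt : (i : ℕ) < t := by
          have : (i : ℕ) ≠ t := fun h => hit (Fin.ext h)
          omega
        simp [extendHist, hi, hlt, hit, Fin.snoc]
    simp only [F, h1, h2, Fin.snoc_last]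
    rw [← prefProb_mul_condD hP0, ← mul_sub, abs_mul, abs_of_nonneg (prefProb_nonneg hP0 _ _)]
  have hsum : ∑ y : Fin k → V, |hybrid P (t + 1) y - hybrid P t y| = ∑ h, F h := by
    simp only [hdiff]
    exact sum_prefix_mul_prod t.is_lt F (marg P) fun i => (sum_marg P i).trans hP1
  unfold tv expCondTV
  rw [hsum, ← (Fin.snocEquiv fun _ : Fin (t + 1) => V).sum_comp, Fintype.sum_prod_type, sum_comm,
    mul_sum]
  refine sum_congr rfl fun h _ => ?_
  rw [tv, mul_left_comm]
  congr 1
  rw [mul_sum]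
  exact sum_congr rfl fun v _ => hF h v

theorem expCondTV_of_val_eq_zero [Nonempty V] (hP1 : ∑ y, P y = 1) {t : Fin k}
    (ht : (t : ℕ) = 0) : expCondTV P t = 0 := by
  have hcond : ∀ z, condD P t z = marg P t := by
    intro z
    funext v
    have hiff : ∀ y : Fin k → V,
        (∀ i : Fin k, (i : ℕ) < (t : ℕ) + 1 → y i = Function.update z t v i) ↔ y t = v := by
      intro y
      constructor
      · intro h
        simpa using h t (Nat.lt_succ_self _)
      · rintro rfl i hi
        obtain rfl : i = t := Fin.ext (by omega)
        simp
    rw [condD, ht, prefProb_zero, hP1, div_one, ← ht]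
    simp only [prefProb, marg, hiff]
  simp [expCondTV, hcond, tv]

theorem tv_prod_marg_le [Nonempty V] (hP0 : ∀ y, 0 ≤ P y) (hP1 : ∑ y, P y = 1) :
    tv P (fun y => ∏ t, marg P t (y t)) ≤
      ∑ t ∈ univ.filter (fun t : Fin k => 1 ≤ (t : ℕ)), expCondTV P t := by
  have h := tv_le_sum_range (hybrid P) k
  rw [hybrid_self, hybrid_zero hP1, ← Fin.sum_univ_eq_sum_range
    (fun t => tv (hybrid P (t + 1)) (hybrid P t))] at h
  simp only [tv_hybrid_succ hP0 hP1] at h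
  refine h.trans_eq (sum_filter_of_ne fun t _ hne => ?_).symm
  exact Nat.one_le_iff_ne_zero.2 fun h0 => hne (expCondTV_of_val_eq_zero hP1 h0)

end Hybrid

/-- operational coupling interpretation of Theorem 1. Under
sub-additivity with pairwise dependencies `D` accumulating to at most `τ ∈ [0,1]`,
there exists a coupling `π` of the joint `P` and the product of its marginals under
which the two samples agree with probability at least `1 - τ`. -/
theorem stmt7 {V : Type*} [Fintype V] [DecidableEq V] [Nonempty V] {k : ℕ} (hk : 1 ≤ k)
    (P : (Fin k → V) → ℝ) (hP0 : ∀ y, 0 ≤ P y) (hP1 : ∑ y, P y = 1)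
    (D : Fin k → Fin k → ℝ) (hD : ∀ i j, 0 ≤ D i j)
    (τ : ℝ) (hτ0 : 0 ≤ τ) (hτ1 : τ ≤ 1)
    (hsub : ∀ t : Fin k, 1 ≤ (t : ℕ) →
      expCondTV P t ≤ ∑ j ∈ univ.filter (fun j : Fin k => j < t), D t j)
    (hsum : ∑ t ∈ univ.filter (fun t : Fin k => 1 ≤ (t : ℕ)),
        ∑ j ∈ univ.filter (fun j : Fin k => j < t), D t j ≤ τ) :
    ∃ π : (Fin k → V) × (Fin k → V) → ℝ,
      (∀ x, 0 ≤ π x) ∧ (∑ x, π x = 1) ∧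
      (∀ a, ∑ b, π (a, b) = P a) ∧
      (∀ b, ∑ a, π (a, b) = ∏ t, marg P t (b t)) ∧
      1 - τ ≤ ∑ x ∈ univ.filter (fun x : (Fin k → V) × (Fin k → V) => x.1 = x.2), π x := by
  have htv : tv P (fun y => ∏ t, marg P t (y t)) ≤ τ :=
    (tv_prod_marg_le hP0 hP1).trans <|
      (sum_le_sum fun t ht => hsub t (mem_filter.1 ht).2).trans hsum
  have hprod : ∑ y : Fin k → V, ∏ t, marg P t (y t) = 1 := by
    rw [← Fintype.prod_sum]
    simp [sum_marg, hP1]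
  obtain ⟨π, h0, h1, hfst, hsnd, hdiag⟩ := exists_maximal_coupling P _ hP0
    (fun y => prod_nonneg fun t _ => marg_nonneg hP0 t (y t)) hP1 hprod
  exact ⟨π, h0, h1, hfst, hsnd, by linarith⟩
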